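/- arXiv:quant-ph/0606211 — 5 statements merged into one kernel-verified Lean document; each statement's English description precedes it below -/
import Mathlib

section
/- The Choi map Φ_C : M_3(ℂ) → M_3(ℂ), defined as the linear map with Φ_C(e_{11}) = e_{11} + e_{22}, Φ_C(e_{22}) = e_{22} + e_{33}, Φ_C(e_{33}) = e_{33} + e_{11}, and Φ_C(e_{ij}) = −e_{ij} for i ≠ j, is a positive map: it sends every positive semidefinite 3×3 complex matrix to a positive semidefinite matrix. -/
open Matrix BigOperators ComplexOrder

lemma choi_real_key (a b c x y z : ℝ) :
    (a*x+b*y+c*z)^2 ≤ (2*a^2+c^2)*x^2 + (2*b^2+a^2)*y^2 + (2*c^2+b^2)*z^2 := by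
  by_cases ha : a = 0
  · subst ha
    nlinarith [sq_nonneg (b*y-c*z), sq_nonneg (c*x), sq_nonneg (b*z)]
  by_cases hb : b = 0
  · subst hb
    nlinarith [sq_nonneg (a*x-c*z), sq_nonneg (c*x), sq_nonneg (a*y)]
  by_cases hc : c = 0
  · subst hc
    nlinarith [sq_nonneg (b*y-a*x), sq_nonneg (a*y), sq_nonneg (b*z)]
  have hA : 0 < a^2 := by positivity
  have hB : 0 < b^2 := by positivity
  have hC : 0 < c^2 := by positivity
  have key : a^2/(2*a^2+c^2) + b^2/(2*b^2+a^2) + c^2/(2*c^2+b^2) ≤ 1 := by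
    generalize a^2 = A at *
    generalize b^2 = B at *
    generalize c^2 = C at *
    rw [div_add_div _ _ (by positivity) (by positivity), div_add_div _ _ (by positivity)
      (by positivity), div_le_one (by positivity)]
    -- AM-GM for a cyclic cubic
    have amgm : 3*(A*B*C) ≤ A^2*B + B^2*C + C^2*A := by
      have h1 : 0 < A + B + C := by positivity
      by_contra hlt
      push Not at hlt
      have := mul_lt_mul_of_pos_left hlt h1
      nlinarith [sq_nonneg (A*B-B*C), sq_nonneg (B*C-C*A), sq_nonneg (C*A-A*B),
        mul_nonneg (mul_pos hA hB).le (sq_nonneg (A-C)), mul_nonneg (mul_pos hA hB).le (sq_nonneg (A-B)),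
        mul_nonneg (mul_pos hA hB).le (sq_nonneg (B-C)),
        mul_nonneg (mul_pos hB hC).le (sq_nonneg (A-C)), mul_nonneg (mul_pos hB hC).le (sq_nonneg (A-B)),
        mul_nonneg (mul_pos hB hC).le (sq_nonneg (B-C)),
        mul_nonneg (mul_pos hA hC).le (sq_nonneg (A-C)), mul_nonneg (mul_pos hA hC).le (sq_nonneg (A-B)),
        mul_nonneg (mul_pos hA hC).le (sq_nonneg (B-C))]
    nlinarith [amgm]
  have cs := Finset.sum_sq_le_sum_mul_sum_of_sq_le_mul (Finset.univ : Finset (Fin 3))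
    (r := ![a*x, b*y, c*z]) (f := ![a^2/(2*a^2+c^2), b^2/(2*b^2+a^2), c^2/(2*c^2+b^2)])
    (g := ![(2*a^2+c^2)*x^2, (2*b^2+a^2)*y^2, (2*c^2+b^2)*z^2])
    (by intro i _; fin_cases i <;> simp <;> positivity)
    (by intro i _; fin_cases i <;> simp <;> positivity)
    (by intro i _; fin_cases i <;> simp <;> field_simp <;> exact le_rfl)
  simp only [Fin.sum_univ_three, Matrix.cons_val] at cs
  refine cs.trans (mul_le_of_le_one_left (by positivity) key)

lemma choi_apply (Φ : Matrix (Fin 3) (Fin 3) ℂ →ₗ[ℂ] Matrix (Fin 3) (Fin 3) ℂ)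
    (h11 : Φ (Matrix.single 0 0 1) = Matrix.single 0 0 1 + Matrix.single 1 1 1)
    (h22 : Φ (Matrix.single 1 1 1) = Matrix.single 1 1 1 + Matrix.single 2 2 1)
    (h33 : Φ (Matrix.single 2 2 1) = Matrix.single 2 2 1 + Matrix.single 0 0 1)
    (hoff : ∀ i j : Fin 3, i ≠ j →
      Φ (Matrix.single i j 1) = -Matrix.single i j 1) (X : Matrix (Fin 3) (Fin 3) ℂ) :
    Φ X = !![X 0 0 + X 2 2, -X 0 1, -X 0 2; -X 1 0, X 1 1 + X 0 0, -X 1 2;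
      -X 2 0, -X 2 1, X 2 2 + X 1 1] := by
  have hX : X = ∑ i, ∑ j, X i j • Matrix.single i j (1:ℂ) := by
    conv_lhs => rw [Matrix.matrix_eq_sum_single X]
    simp [Matrix.smul_single]
  conv_lhs => rw [hX]
  simp only [map_add, map_smul, Fin.sum_univ_three, h11, h22, h33,
    hoff 0 1 (by decide), hoff 0 2 (by decide), hoff 1 0 (by decide), hoff 1 2 (by decide),
    hoff 2 0 (by decide), hoff 2 1 (by decide)]
  ext i j
  fin_cases i <;> fin_cases j <;> simp [add_comm]

lemma choi_rank_one (v : Fin 3 → ℂ) (y : Fin 3 → ℂ) :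
    ‖v 0 * y 0 + v 1 * y 1 + v 2 * y 2‖^2 ≤
      (2*‖v 0‖^2+‖v 2‖^2)*‖y 0‖^2 + (2*‖v 1‖^2+‖v 0‖^2)*‖y 1‖^2
        + (2*‖v 2‖^2+‖v 1‖^2)*‖y 2‖^2 := by
  refine le_trans ?_ (choi_real_key ‖v 0‖ ‖v 1‖ ‖v 2‖ ‖y 0‖ ‖y 1‖ ‖y 2‖)
  gcongr
  simpa using norm_add₃_le (a := v 0 * y 0) (b := v 1 * y 1) (c := v 2 * y 2)

theorem stmt4 (Φ : Matrix (Fin 3) (Fin 3) ℂ →ₗ[ℂ] Matrix (Fin 3) (Fin 3) ℂ)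
    (h11 : Φ (Matrix.single 0 0 1) = Matrix.single 0 0 1 + Matrix.single 1 1 1)
    (h22 : Φ (Matrix.single 1 1 1) = Matrix.single 1 1 1 + Matrix.single 2 2 1)
    (h33 : Φ (Matrix.single 2 2 1) = Matrix.single 2 2 1 + Matrix.single 0 0 1)
    (hoff : ∀ i j : Fin 3, i ≠ j →
      Φ (Matrix.single i j 1) = -Matrix.single i j 1) :
    ∀ X : Matrix (Fin 3) (Fin 3) ℂ, X.PosSemidef → (Φ X).PosSemidef := by
  intro X hX
  open scoped MatrixOrder Matrix.Norms.L2Operator in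
  obtain ⟨B, rfl⟩ := CStarAlgebra.nonneg_iff_eq_star_mul_self.mp hX.nonneg
  have hB : Bᴴ * B = ∑ k, Matrix.vecMulVec (star (B k)) (B k) := by
    ext i j
    simp [Matrix.mul_apply, Matrix.sum_apply, Matrix.vecMulVec_apply]
  rw [Matrix.star_eq_conjTranspose, hB, map_sum]
  refine Matrix.posSemidef_sum _ fun k _ => ?_
  rw [choi_apply Φ h11 h22 h33 hoff]
  generalize B k = v
  refine Matrix.PosSemidef.of_dotProduct_mulVec_nonneg ?_ fun y => ?_
  · ext i j
    fin_cases i <;> fin_cases j <;> simp [Matrix.vecMulVec_apply, mul_comm]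
  · have h := choi_rank_one v y
    rw [← sub_nonneg] at h
    have h' := Complex.zero_le_real.mpr h
    convert h' using 1
    push_cast
    simp only [← Complex.conj_mul']
    simp [dotProduct, Matrix.mulVec, Fin.sum_univ_three, Matrix.vecMulVec_apply]
    ring
end

section
/- Let d ≥ 2, let A be a Hermitian positive semidefinite d×d complex matrix, and let D_{ij} ≥ 0 (for i ≠ j) be real numbers satisfying D_{ij}·D_{ji} ≥ |A_{ij}|² for all i ≠ j. Then the matrix ρ = Σ_{i,j} A_{ij} (e_{ij} ⊗ e_{ij}) + Σ_{i≠j} D_{ij} (e_{ii} ⊗ e_{jj}) ∈ M_{d²}(ℂ) is PPT: both ρ and its partial transpose (id ⊗ τ)ρ = Σ_{i,j} A_{ij} (e_{ij} ⊗ e_{ji}) + Σ_{i≠j} D_{ij} (e_{ii} ⊗ e_{jj}) are positive semidefinite. -/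
open Matrix BigOperators ComplexOrder Kronecker

noncomputable section

/-- Partial transposition `(id ⊗ τ)` on `M_d(ℂ) ⊗ M_d(ℂ) ≅ M_{d²}(ℂ)`:
`∑ e_{ij} ⊗ ρ_{ij} ↦ ∑ e_{ij} ⊗ ρ_{ij}ᵀ`. -/
def ptrans {d : ℕ} (ρ : Matrix (Fin d × Fin d) (Fin d × Fin d) ℂ) :
    Matrix (Fin d × Fin d) (Fin d × Fin d) ℂ :=
  Matrix.of fun p q => ρ (p.1, q.2) (q.1, p.2)

/-- `ρ = ∑_{i,j} A_{ij} (e_{ij} ⊗ e_{ij}) + ∑_{i≠j} D_{ij} (e_{ii} ⊗ e_{jj})`. -/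
def rhoAD {d : ℕ} (A : Matrix (Fin d) (Fin d) ℂ) (D : Fin d → Fin d → ℝ) :
    Matrix (Fin d × Fin d) (Fin d × Fin d) ℂ :=
  (∑ i, ∑ j, A i j • (Matrix.single i j (1 : ℂ) ⊗ₖ Matrix.single i j (1 : ℂ))) +
    ∑ i, ∑ j, (if i = j then 0 else ((D i j : ℝ) : ℂ)) •
      (Matrix.single i i (1 : ℂ) ⊗ₖ Matrix.single j j (1 : ℂ))

lemma rhoAD_apply {d : ℕ} (A : Matrix (Fin d) (Fin d) ℂ) (D : Fin d → Fin d → ℝ)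
    (a b c e : Fin d) : rhoAD A D (a, b) (c, e) =
      (if a = b ∧ c = e then A a c else 0) +
      (if a = c ∧ b = e then (if a = b then 0 else ((D a b : ℝ) : ℂ)) else 0) := by
  unfold rhoAD
  simp only [Matrix.add_apply, Matrix.sum_apply, Matrix.smul_apply, Matrix.kroneckerMap_apply,
    Matrix.single_apply, smul_eq_mul, mul_ite, mul_one, mul_zero]
  congr 1
  · rw [Finset.sum_eq_single a, Finset.sum_eq_single c]
    · by_cases h1 : a = b <;> by_cases h2 : c = e <;> simp [h1, h2]
    · intro j _ hj; simp [hj]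
    · simp
    · intro j _ hj; simp [hj]
    · simp
  · rw [Finset.sum_eq_single a, Finset.sum_eq_single b]
    · by_cases h1 : a = c <;> by_cases h2 : b = e <;> simp [h1, h2]
    · intro j _ hj; simp [hj]
    · simp
    · intro j _ hj; simp [hj]
    · simp

lemma two_aux (a p q x y : ℝ) (hp : 0 ≤ p) (hq : 0 ≤ q)
    (h : a ^ 2 ≤ p * q) : 2 * (a * x * y) ≤ p * x ^ 2 + q * y ^ 2 := by
  refine (abs_le_of_sq_le_sq' ?_ (by positivity)).2
  have h1 : a ^ 2 * (x * y) ^ 2 ≤ p * q * (x * y) ^ 2 :=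
    mul_le_mul_of_nonneg_right h (sq_nonneg _)
  nlinarith [sq_nonneg (p * x ^ 2 - q * y ^ 2)]

theorem stmt8 {d : ℕ} (hd : 2 ≤ d) (A : Matrix (Fin d) (Fin d) ℂ) (hA : A.PosSemidef)
    (D : Fin d → Fin d → ℝ) (hD : ∀ i j, i ≠ j → 0 ≤ D i j)
    (hDA : ∀ i j, i ≠ j → ‖A i j‖ ^ 2 ≤ D i j * D j i) :
    (rhoAD A D).PosSemidef ∧ (ptrans (rhoAD A D)).PosSemidef := by
  have hH : ∀ i j, star (A i j) = A j i := fun i j => hA.1.apply j i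
  constructor
  · have key : rhoAD A D =
        (Matrix.of fun (p : Fin d × Fin d) (c : Fin d) =>
          if p.1 = p.2 ∧ p.1 = c then (1 : ℂ) else 0) * A *
        (Matrix.of fun (p : Fin d × Fin d) (c : Fin d) =>
          if p.1 = p.2 ∧ p.1 = c then (1 : ℂ) else 0)ᴴ +
        Matrix.diagonal (fun p : Fin d × Fin d =>
          if p.1 = p.2 then 0 else ((D p.1 p.2 : ℝ) : ℂ)) := by
      ext ⟨a, b⟩ ⟨c, e⟩
      rw [rhoAD_apply, Matrix.add_apply, Matrix.diagonal_apply]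
      congr 1
      · by_cases h1 : a = b <;> by_cases h2 : c = e <;>
          simp [Matrix.mul_apply, h1, h2, apply_ite]
      · simp [Prod.ext_iff]
    rw [key]
    refine (hA.mul_mul_conjTranspose_same _).add (Matrix.PosSemidef.diagonal ?_)
    rintro ⟨a, b⟩
    by_cases h : a = b
    · simp [h]
    · simpa [h] using hD a b h
  · have hpt : ∀ a b c e, ptrans (rhoAD A D) (a, b) (c, e) =
        (if a = e ∧ c = b then A a c else 0) +
        (if a = c ∧ e = b then (if a = e then 0 else ((D a e : ℝ) : ℂ)) else 0) :=
      fun a b c e => rhoAD_apply A D a e c b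
    rw [Matrix.posSemidef_iff_dotProduct_mulVec]
    constructor
    · ext ⟨a, b⟩ ⟨c, e⟩
      rw [Matrix.conjTranspose_apply, hpt, hpt, star_add]
      congr 1
      · rw [apply_ite star, hH, star_zero]; exact if_congr and_comm rfl rfl
      · by_cases h1 : a = c <;> by_cases h2 : e = b
        · subst h1 h2; by_cases h3 : a = e <;> simp [h3]
        all_goals simp [h1, h2, eq_comm (a := c) (b := a), eq_comm (a := b) (b := e)]
    · intro x
      set f : Fin d → Fin d → ℂ := fun i j => star (x (i, j)) * (A i j * x (j, i) +
        (if i = j then 0 else ((D i j : ℝ) : ℂ)) * x (i, j)) with hf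
      have hS : star x ⬝ᵥ (ptrans (rhoAD A D) *ᵥ x) = ∑ i, ∑ j, f i j := by
        simp only [dotProduct, Matrix.mulVec, Fintype.sum_prod_type, Pi.star_apply, hf]
        refine Finset.sum_congr rfl fun a _ => Finset.sum_congr rfl fun b _ => ?_
        congr 1
        simp only [hpt, add_mul, Finset.sum_add_distrib]
        congr 1
        · rw [Finset.sum_eq_single b, Finset.sum_eq_single a]
          · simp
          · intro j _ hj; simp [Ne.symm hj]
          · simp
          · intro j _ hj; simp [hj]
          · simp
        · rw [Finset.sum_eq_single a, Finset.sum_eq_single b]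
          · simp
          · intro j _ hj; simp [hj]
          · simp
          · intro j _ hj; simp [Ne.symm hj]
          · simp
      have hpair : ∀ i j, 0 ≤ f i j + f j i := by
        intro i j
        by_cases h : i = j
        · subst h
          have h0 : 0 ≤ f i i := by
            have : f i i = A i i * (star (x (i,i)) * x (i,i)) := by simp [hf]; ring
            rw [this]
            exact mul_nonneg hA.diag_nonneg (star_mul_self_nonneg _)
          exact add_nonneg h0 h0
        · set z : ℂ := star (x (i,j)) * A i j * x (j,i) with hz
          have e1 : f i j + f j i = ((2 * z.re + (D i j * ‖x (i,j)‖^2 + D j i * ‖x (j,i)‖^2) : ℝ) : ℂ) := by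
            have e2 : ((2 * z.re : ℝ) : ℂ) = z + star z := by
              rw [← Complex.add_conj]; rfl
            have n1 : ∀ w : ℂ, ((‖w‖ : ℂ))^2 = star w * w := fun w => (Complex.conj_mul' w).symm
            rw [Complex.ofReal_add, e2]
            push_cast
            rw [n1, n1, hz]
            simp only [hf, h, Ne.symm h, if_false, star_mul, star_star, hH]
            ring
          rw [e1, Complex.zero_le_real]
          have e3 : |z.re| ≤ ‖A i j‖ * ‖x (i,j)‖ * ‖x (j,i)‖ := by
            refine (Complex.abs_re_le_norm z).trans (le_of_eq ?_)
            rw [hz, norm_mul, norm_mul, norm_star]; ring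
          have e4 := two_aux ‖A i j‖ (D i j) (D j i) ‖x (i,j)‖ ‖x (j,i)‖ (hD _ _ h)
            (hD _ _ (Ne.symm h)) (hDA _ _ h)
          have := neg_abs_le z.re
          linarith
      have h2 : 0 ≤ (2 : ℂ) * ∑ i, ∑ j, f i j := by
        have : (2 : ℂ) * ∑ i, ∑ j, f i j = ∑ i, ∑ j, (f i j + f j i) := by
          simp only [Finset.sum_add_distrib]
          rw [Finset.sum_comm (f := fun i j => f j i)]; ring
        rw [this]
        exact Finset.sum_nonneg fun i _ => Finset.sum_nonneg fun j _ => hpair i j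
      rw [hS]
      have h3 := mul_nonneg (show (0:ℂ) ≤ ((2⁻¹ : ℝ) : ℂ) by
        rw [Complex.zero_le_real]; norm_num) h2
      simpa using h3
end
end

section
/- Let k ≥ 1 and d = 2k+1. Let α_0, α_1, …, α_{d−1} be nonnegative reals with α_0 + ⋯ + α_{d−1} = 1, and let a_{ij} = α_{(j−i) mod d} be the associated cyclic bistochastic matrix. Let φ : M_d(ℂ) → M_d(ℂ) be the linear map with φ(e_{ii}) = Σ_{j=1}^d a_{ij} e_{jj} and φ(e_{ij}) = −(1/(d−1))·e_{ij} for i ≠ j, and assume φ is positive. If either (α_1 + ⋯ + α_k > 0 and α_1 + ⋯ + α_k ≠ α_{k+1} + ⋯ + α_{2k}), or (α_1 + ⋯ + α_k = 0 and 0 < α_0 < 1), then φ is indecomposable: there exist no completely positive map φ₁ and completely copositive map φ₂ with φ = φ₁ + φ₂. -/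
open Matrix BigOperators ComplexOrder
open scoped Fin.NatCast

noncomputable section

/-- `id_{M_n} ⊗ φ` : apply `φ` to each `d × d` block of an `n × n` block matrix. -/
def blockMap {n d : ℕ} (φ : Matrix (Fin d) (Fin d) ℂ → Matrix (Fin d) (Fin d) ℂ)
    (ρ : Matrix (Fin n × Fin d) (Fin n × Fin d) ℂ) :
    Matrix (Fin n × Fin d) (Fin n × Fin d) ℂ :=
  Matrix.of fun p q => φ (Matrix.of fun s t => ρ (p.1, s) (q.1, t)) p.2 q.2

/-- Complete positivity. -/
def IsCP {d : ℕ} (φ : Matrix (Fin d) (Fin d) ℂ → Matrix (Fin d) (Fin d) ℂ) : Prop :=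
  ∀ n : ℕ, ∀ ρ : Matrix (Fin n × Fin d) (Fin n × Fin d) ℂ,
    ρ.PosSemidef → (blockMap φ ρ).PosSemidef

/-- Complete copositivity: `X ↦ φ(Xᵀ)` is completely positive. -/
def IsCcP {d : ℕ} (φ : Matrix (Fin d) (Fin d) ℂ → Matrix (Fin d) (Fin d) ℂ) : Prop :=
  IsCP fun X => φ Xᵀ


theorem aux_sum_split {k : ℕ} (f : Fin (2 * k + 1) → ℝ) :
    ∑ m, f m = f 0 + ∑ m ∈ Finset.Icc 1 k, f (m : Fin (2 * k + 1)) +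
      ∑ m ∈ Finset.Icc (k + 1) (2 * k), f (m : Fin (2 * k + 1)) := by
  have h1 : ∑ m, f m = ∑ m ∈ Finset.range (2 * k + 1), f (m : Fin (2 * k + 1)) := by
    rw [← Fin.sum_univ_eq_sum_range (fun m : ℕ => f (m : Fin (2 * k + 1)))]
    apply Finset.sum_congr rfl
    intro i _
    simp
  have h2 : Finset.Icc 1 k = Finset.Ico 1 (k + 1) := by ext; simp; try omega
  have h3 : Finset.Icc (k + 1) (2 * k) = Finset.Ico (k + 1) (2 * k + 1) := by ext; simp; try omega
  rw [h1, h2, h3, Finset.range_eq_Ico, add_assoc, Finset.sum_Ico_consecutive _ (by omega) (by omega),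
    Finset.sum_eq_sum_Ico_succ_bot (by omega)]
  simp

def auxg (k : ℕ) (r : ℝ) (m : Fin (2 * k + 1)) : ℝ :=
  if m = 0 then 1 else if m.val ≤ k then r else r⁻¹

theorem auxg_zero (k : ℕ) (r : ℝ) : auxg k r 0 = 1 := by simp [auxg]

theorem auxg_neg (k : ℕ) (r : ℝ) (hr : 0 < r) (m : Fin (2 * k + 1)) :
    auxg k r m * auxg k r (-m) = 1 := by
  by_cases hm : m = 0
  · simp [hm, auxg]
  have hm' : -m ≠ 0 := by simpa using hm
  have hv : (-m).val = 2 * k + 1 - m.val := by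
    rw [Fin.val_neg]; simp [hm]
  have h0 : m.val ≠ 0 := fun h => hm (Fin.ext (by simpa using h))
  have hlt := m.isLt
  unfold auxg
  rw [if_neg hm, if_neg hm', hv]
  by_cases h : m.val ≤ k
  · rw [if_pos h, if_neg (by omega)]; field_simp
  · rw [if_neg h, if_pos (by omega)]; field_simp

theorem aux_exists_r (A B : ℝ) (hA : 0 ≤ A) (hB : 0 ≤ B) (hAB : A ≠ B) :
    ∃ r : ℝ, 0 < r ∧ r ^ 2 * A + (r⁻¹) ^ 2 * B < A + B := by
  have key : ∃ t : ℝ, 0 < t ∧ (t - 1) * (A * t - B) < 0 := by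
    rcases lt_or_gt_of_ne hAB with h | h
    · have hS : 0 < A + B := by linarith
      have hB' : 0 < B := by linarith
      refine ⟨2 * B / (A + B), by positivity, mul_neg_of_pos_of_neg ?_ ?_⟩
      · rw [sub_pos, lt_div_iff₀ hS]; linarith
      · rw [sub_neg, ← mul_div_assoc, div_lt_iff₀ hS]; nlinarith
    · have hA' : 0 < A := by linarith
      refine ⟨(A + B) / (2 * A), by positivity, mul_neg_of_neg_of_pos ?_ ?_⟩
      · rw [sub_neg, div_lt_iff₀ (by linarith)]; linarith
      · have : A * ((A + B) / (2 * A)) = (A + B) / 2 := by field_simp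
        rw [this]; linarith
  obtain ⟨t, ht, h⟩ := key
  refine ⟨√t, Real.sqrt_pos.2 ht, ?_⟩
  rw [inv_pow, Real.sq_sqrt ht.le]
  have : t * A + t⁻¹ * B - (A + B) = ((t - 1) * (A * t - B)) / t := by field_simp; ring
  have h2 := div_neg_of_neg_of_pos h ht
  linarith

/-- The witness. -/
def auxrho (k : ℕ) (r : ℝ) :
    Matrix (Fin (2 * k + 1) × Fin (2 * k + 1)) (Fin (2 * k + 1) × Fin (2 * k + 1)) ℂ :=
  Matrix.of fun p q =>
    if p.1 = q.1 then (if p.2 = q.2 then ((auxg k r (p.1 - p.2) ^ 2 : ℝ) : ℂ) else 0)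
    else if p.2 = p.1 ∧ q.2 = q.1 then 1 else 0

/-- Its partial transpose. -/
def auxsig (k : ℕ) (r : ℝ) :
    Matrix (Fin (2 * k + 1) × Fin (2 * k + 1)) (Fin (2 * k + 1) × Fin (2 * k + 1)) ℂ :=
  Matrix.of fun p q => auxrho k r (p.1, q.2) (q.1, p.2)

theorem auxrho_psd (k : ℕ) (r : ℝ) : (auxrho k r).PosSemidef := by
  let v : Fin (2 * k + 1) × Fin (2 * k + 1) → ℂ := fun p => if p.2 = p.1 then 1 else 0
  let D : Fin (2 * k + 1) × Fin (2 * k + 1) → ℂ := fun p =>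
    if p.2 = p.1 then 0 else ((auxg k r (p.1 - p.2) ^ 2 : ℝ) : ℂ)
  have h : auxrho k r = vecMulVec v (star v) + diagonal D := by
    ext ⟨i, s⟩ ⟨j, t⟩
    simp only [auxrho, of_apply, Matrix.add_apply, vecMulVec_apply, Pi.star_apply, diagonal_apply, v, D,
      Prod.mk.injEq]
    by_cases h1 : i = j
    · subst h1
      by_cases h2 : s = t
      · subst h2
        by_cases h3 : s = i
        · subst h3; simp [auxg_zero]
        · simp [h3]
      · by_cases h3 : s = i
        · have h4 : ¬ t = i := fun h => h2 (h3.trans h.symm)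
          simp [h2, h4]
        · simp [h2, h3]
    · by_cases h3 : s = i <;> by_cases h4 : t = j <;> simp [h1, h3, h4]
  rw [h]
  refine (posSemidef_vecMulVec_self_star v).add (PosSemidef.diagonal ?_)
  intro p
  simp only [D, Pi.zero_apply]
  split_ifs
  · exact le_rfl
  · exact_mod_cast sq_nonneg (auxg k r (p.1 - p.2))

theorem auxsig_psd (k : ℕ) (r : ℝ) (hr : 0 < r) : (auxsig k r).PosSemidef := by
  let D : Fin (2 * k + 1) × Fin (2 * k + 1) → ℂ := fun p => ((auxg k r (p.1 - p.2) : ℝ) : ℂ)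
  let e : Fin (2 * k + 1) × Fin (2 * k + 1) → Sym2 (Fin (2 * k + 1)) := fun p => s(p.1, p.2)
  have h : auxsig k r = (diagonal D)ᴴ *
      ((1 : Matrix (Sym2 (Fin (2 * k + 1))) (Sym2 (Fin (2 * k + 1))) ℂ).submatrix e e) *
        diagonal D := by
    ext ⟨i, s⟩ ⟨j, t⟩
    rw [diagonal_conjTranspose, mul_diagonal, diagonal_mul]
    simp only [auxsig, auxrho, of_apply, submatrix_apply, one_apply, e, D, Pi.star_apply,
      Sym2.eq_iff]
    by_cases h1 : i = j
    · subst h1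
      by_cases h2 : s = t
      · subst h2
        simp [sq]
      · have h3 : ¬ (i = t ∧ s = i) := fun h => h2 (h.2.trans h.1)
        simp [h2, Ne.symm h2, h3]
    · by_cases h2 : t = i ∧ s = j
      · obtain ⟨rfl, rfl⟩ := h2
        have := auxg_neg k r hr (t - s)
        rw [neg_sub] at this
        simp [h1]
        exact_mod_cast this.symm
      · have h3 : ¬ (i = t ∧ s = j) := fun h => h2 ⟨h.1.symm, h.2⟩
        simp [h1, h2, h3]
  rw [h]
  exact (PosSemidef.one.submatrix e).conjTranspose_mul_mul_same _

theorem aux_pair {d : ℕ} (M : Matrix (Fin d × Fin d) (Fin d × Fin d) ℂ) (hM : M.PosSemidef) :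
    0 ≤ ∑ i, ∑ j, M (i, i) (j, j) := by
  have h := (hM.submatrix (fun i : Fin d => (i, i))).dotProduct_mulVec_nonneg (fun _ => 1)
  simpa [dotProduct, mulVec] using h

theorem stmt10 {k : ℕ} (hk : 1 ≤ k) (α : Fin (2 * k + 1) → ℝ)
    (hα : ∀ m, 0 ≤ α m) (hsumα : ∑ m, α m = 1)
    (Φ : Matrix (Fin (2 * k + 1)) (Fin (2 * k + 1)) ℂ →ₗ[ℂ]
          Matrix (Fin (2 * k + 1)) (Fin (2 * k + 1)) ℂ)
    (hdiag : ∀ i, Φ (Matrix.single i i 1) =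
      ∑ j, ((α (j - i) : ℝ) : ℂ) • Matrix.single j j (1 : ℂ))
    (hoff : ∀ i j, i ≠ j → Φ (Matrix.single i j 1) =
      (-(1 / ((2 * k + 1 : ℂ) - 1))) • Matrix.single i j (1 : ℂ))
    (hpos : ∀ X, X.PosSemidef → (Φ X).PosSemidef)
    (hcond :
      ((0 < ∑ m ∈ Finset.Icc 1 k, α (m : Fin (2 * k + 1)) ∧
          (∑ m ∈ Finset.Icc 1 k, α (m : Fin (2 * k + 1))) ≠
            ∑ m ∈ Finset.Icc (k + 1) (2 * k), α (m : Fin (2 * k + 1))) ∨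
        ((∑ m ∈ Finset.Icc 1 k, α (m : Fin (2 * k + 1))) = 0 ∧
          0 < α 0 ∧ α 0 < 1))) :
    ¬ ∃ (φ₁ φ₂ : Matrix (Fin (2 * k + 1)) (Fin (2 * k + 1)) ℂ →ₗ[ℂ]
          Matrix (Fin (2 * k + 1)) (Fin (2 * k + 1)) ℂ),
        IsCP ⇑φ₁ ∧ IsCcP ⇑φ₂ ∧ Φ = φ₁ + φ₂ := by
  rintro ⟨φ₁, φ₂, h1, h2, hΦ⟩
  set A := ∑ m ∈ Finset.Icc 1 k, α (m : Fin (2 * k + 1)) with hA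
  set B := ∑ m ∈ Finset.Icc (k + 1) (2 * k), α (m : Fin (2 * k + 1)) with hB
  have hsplit := aux_sum_split α
  rw [hsumα, ← hA, ← hB] at hsplit
  have hA0 : 0 ≤ A := Finset.sum_nonneg fun _ _ => hα _
  have hB0 : 0 ≤ B := Finset.sum_nonneg fun _ _ => hα _
  have hAB : A ≠ B := by
    rcases hcond with h | h
    · exact h.2
    · intro hh
      linarith [h.1, h.2.2]
  obtain ⟨r, hr, hlt⟩ := aux_exists_r A B hA0 hB0 hAB
  have hsum : ∑ m, auxg k r m ^ 2 * α m = α 0 + r ^ 2 * A + (r⁻¹) ^ 2 * B := by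
    rw [aux_sum_split (fun m => auxg k r m ^ 2 * α m), auxg_zero, hA, hB, Finset.mul_sum,
      Finset.mul_sum]
    congr 1
    · congr 1
      · simp
      · apply Finset.sum_congr rfl
        intro m hm
        rw [Finset.mem_Icc] at hm
        have hv : ((m : Fin (2 * k + 1))).val = m := by
          rw [Fin.val_natCast, Nat.mod_eq_of_lt (by omega)]
        have h0 : (m : Fin (2 * k + 1)) ≠ 0 := by
          intro h
          rw [h] at hv
          simp at hv
          omega
        simp only [auxg, if_neg h0, hv, if_pos hm.2]
    · apply Finset.sum_congr rfl
      intro m hm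
      rw [Finset.mem_Icc] at hm
      have hv : ((m : Fin (2 * k + 1))).val = m := by
        rw [Fin.val_natCast, Nat.mod_eq_of_lt (by omega)]
      have h0 : (m : Fin (2 * k + 1)) ≠ 0 := by
        intro h
        rw [h] at hv
        simp at hv
        omega
      have h3 : ¬ m ≤ k := by omega
      simp only [auxg, if_neg h0, hv, if_neg h3]
  have hp1 := aux_pair _ (h1 _ _ (auxrho_psd k r))
  have hp2 := aux_pair _ (h2 _ _ (auxsig_psd k r hr))
  let R : Fin (2 * k + 1) → Fin (2 * k + 1) → Matrix (Fin (2 * k + 1)) (Fin (2 * k + 1)) ℂ :=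
    fun i j => Matrix.of fun s t => auxrho k r (i, s) (j, t)
  have hp3 : 0 ≤ ∑ i, ∑ j, Φ (R i j) i j := by
    have : ∑ i, ∑ j, Φ (R i j) i j = (∑ i, ∑ j, blockMap (⇑φ₁) (auxrho k r) (i, i) (j, j)) +
        ∑ i, ∑ j, blockMap (fun X => φ₂ Xᵀ) (auxsig k r) (i, i) (j, j) := by
      rw [← Finset.sum_add_distrib]
      refine Finset.sum_congr rfl fun i _ => ?_
      rw [← Finset.sum_add_distrib]
      refine Finset.sum_congr rfl fun j _ => ?_
      rw [hΦ]
      rfl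
    rw [this]
    exact add_nonneg hp1 hp2
  have hRoff : ∀ i j, i ≠ j → R i j = Matrix.single i j 1 := by
    intro i j hij
    ext s t
    simp only [R, auxrho, of_apply, if_neg hij, single_apply]
    simp only [eq_comm]
  have hRdiag : ∀ i, R i i =
      ∑ s, ((auxg k r (i - s) ^ 2 : ℝ) : ℂ) • Matrix.single s s (1 : ℂ) := by
    intro i
    ext s t
    simp only [R, auxrho, of_apply, if_true, Matrix.sum_apply, Matrix.smul_apply, single_apply,
      smul_eq_mul]
    rw [Finset.sum_eq_single s]
    · simp
    · intro b _ hb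
      simp [hb]
    · simp
  have hVdiag : ∀ i, Φ (R i i) i i = ((α 0 + r ^ 2 * A + (r⁻¹) ^ 2 * B : ℝ) : ℂ) := by
    intro i
    rw [hRdiag, map_sum, Matrix.sum_apply, ← hsum,
      ← (Equiv.subLeft i).sum_comp (fun m => auxg k r m ^ 2 * α m), Complex.ofReal_sum]
    refine Finset.sum_congr rfl fun s _ => ?_
    rw [map_smul, hdiag, Matrix.smul_apply, Matrix.sum_apply, Finset.sum_eq_single i]
    · simp
    · intro b _ hb
      simp [single_apply, hb]
    · simp
  have hk0 : (k : ℝ) ≠ 0 := by positivity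
  have hVoff : ∀ i j, i ≠ j → Φ (R i j) i j = ((-(1 / (2 * k)) : ℝ) : ℂ) := by
    intro i j hij
    rw [hRoff i j hij, hoff i j hij]
    simp
  have htot : ∀ i, ∑ j, Φ (R i j) i j =
      ((α 0 + r ^ 2 * A + (r⁻¹) ^ 2 * B - 1 : ℝ) : ℂ) := by
    intro i
    rw [← Finset.add_sum_erase _ _ (Finset.mem_univ i), hVdiag,
      Finset.sum_congr rfl fun j hj => hVoff i j (Finset.ne_of_mem_erase hj).symm,
      Finset.sum_const, Finset.card_erase_of_mem (Finset.mem_univ i), Finset.card_univ,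
      Fintype.card_fin, Nat.add_sub_cancel, nsmul_eq_mul]
    have : (((2 * k : ℕ) : ℝ)) * (-(1 / (2 * k)) : ℝ) = -1 := by
      push_cast; field_simp
    rw [sub_eq_add_neg, ← this]
    push_cast
    ring
  rw [Finset.sum_congr rfl fun i _ => htot i, Finset.sum_const, Finset.card_univ,
    Fintype.card_fin, nsmul_eq_mul] at hp3
  have hp4 : (0 : ℝ) ≤ ((2 * k + 1 : ℕ) : ℝ) * (α 0 + r ^ 2 * A + (r⁻¹) ^ 2 * B - 1) := by
    exact_mod_cast hp3
  have hp5 : ((2 * k + 1 : ℕ) : ℝ) * (α 0 + r ^ 2 * A + (r⁻¹) ^ 2 * B - 1) < 0 :=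
    mul_neg_of_pos_of_neg (by positivity) (by linarith)
  linarith
end
end

section
/- Let k ≥ 1 and d = 2k. Let α_0, α_1, …, α_{d−1} be nonnegative reals with α_0 + ⋯ + α_{d−1} = 1, and let a_{ij} = α_{(j−i) mod d} be the associated cyclic bistochastic matrix. Let φ : M_d(ℂ) → M_d(ℂ) be the linear map with φ(e_{ii}) = Σ_{j=1}^d a_{ij} e_{jj} and φ(e_{ij}) = −(1/(d−1))·e_{ij} for i ≠ j, and assume φ is positive. If either (α_1 + ⋯ + α_{k−1} > 0 and α_1 + ⋯ + α_{k−1} ≠ α_{k+1} + ⋯ + α_{2k−1}), or (α_1 + ⋯ + α_{k−1} = 0 and 0 < α_0 + α_k < 1), then φ is indecomposable: there exist no completely positive map φ₁ and completely copositive map φ₂ with φ = φ₁ + φ₂. -/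
open Matrix BigOperators ComplexOrder

noncomputable section

/-- Quadratic form of the Choi matrix of a CP map is nonnegative. -/
lemma choi_nonneg {d : ℕ} (φ : Matrix (Fin d) (Fin d) ℂ → Matrix (Fin d) (Fin d) ℂ)
    (h : IsCP φ) (v : Fin d × Fin d → ℂ) :
    0 ≤ ∑ p : Fin d × Fin d, ∑ q : Fin d × Fin d,
      star (v p) * φ (Matrix.single p.1 q.1 1) p.2 q.2 * v q := by
  let w : Fin d × Fin d → ℂ := fun p => if p.1 = p.2 then 1 else 0
  have h1 := h d (Matrix.vecMulVec w (star w)) (Matrix.posSemidef_vecMulVec_self_star w)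
  have h2 := h1.dotProduct_mulVec_nonneg v
  refine h2.trans_eq ?_
  have hs : ∀ a b : Fin d, (Matrix.of fun s t => Matrix.vecMulVec w (star w) (a, s) (b, t))
      = Matrix.single a b (1 : ℂ) := by
    intro a b
    ext s t
    simp [w, Matrix.vecMulVec_apply, Matrix.single_apply, ite_and]
    grind
  simp only [dotProduct, Matrix.mulVec, blockMap, hs, Matrix.of_apply, Pi.star_apply,
    Finset.mul_sum, mul_assoc]

lemma choi_diag {d : ℕ} (φ : Matrix (Fin d) (Fin d) ℂ → Matrix (Fin d) (Fin d) ℂ)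
    (h : IsCP φ) (i j : Fin d) : 0 ≤ (φ (Matrix.single i i 1) j j).re := by
  have := choi_nonneg φ h (Pi.single (i, j) 1)
  rw [Finset.sum_eq_single (i, j), Finset.sum_eq_single (i, j)] at this
  · simpa using (Complex.le_def.1 this).1
  · intro b _ hb; simp [Pi.single_apply, hb]
  · simp
  · intro b _ hb; simp [Pi.single_apply, hb]
  · simp

lemma choi_sum {d : ℕ} (φ : Matrix (Fin d) (Fin d) ℂ → Matrix (Fin d) (Fin d) ℂ)
    (h : IsCP φ) : 0 ≤ ∑ i, ∑ j, (φ (Matrix.single i j 1) i j).re := by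
  have := choi_nonneg φ h (fun p => if p.1 = p.2 then 1 else 0)
  have := (Complex.le_def.1 this).1
  simpa [Fintype.sum_prod_type, apply_ite] using this

lemma choi_pair {d : ℕ} (φ : Matrix (Fin d) (Fin d) ℂ → Matrix (Fin d) (Fin d) ℂ)
    (h : IsCP φ) {i j : Fin d} (hij : i ≠ j) (x y : ℝ) :
    0 ≤ x * x * (φ (Matrix.single i i 1) j j).re + y * y * (φ (Matrix.single j j 1) i i).re
      + x * y * ((φ (Matrix.single i j 1) j i).re + (φ (Matrix.single j i 1) i j).re) := by
  have := choi_nonneg φ h (fun p => (if p = (i, j) then (x : ℂ) else 0)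
    + (if p = (j, i) then (y : ℂ) else 0))
  have := (Complex.le_def.1 this).1
  simp only [star_add, apply_ite star, add_mul, mul_add, Finset.sum_add_distrib, star_zero,
    ite_mul, mul_ite, zero_mul, mul_zero, Finset.sum_ite_eq', Finset.sum_ite_eq,
    Finset.mem_univ, if_true, Finset.sum_ite_irrel, Finset.sum_const_zero] at this
  simp [-Finset.sum_add_distrib] at this
  linarith

theorem stmt11 {k : ℕ} (hk : 1 ≤ k) (α : Fin (2 * k) → ℝ)
    (hα : ∀ m, 0 ≤ α m) (hsumα : ∑ m, α m = 1)
    (Φ : Matrix (Fin (2 * k)) (Fin (2 * k)) ℂ →ₗ[ℂ]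
          Matrix (Fin (2 * k)) (Fin (2 * k)) ℂ)
    (hdiag : ∀ i, Φ (Matrix.single i i 1) =
      ∑ j, ((α (j - i) : ℝ) : ℂ) • Matrix.single j j (1 : ℂ))
    (hoff : ∀ i j, i ≠ j → Φ (Matrix.single i j 1) =
      (-(1 / ((2 * k : ℂ) - 1))) • Matrix.single i j (1 : ℂ))
    (hpos : ∀ X, X.PosSemidef → (Φ X).PosSemidef)
    (hcond :
      ((0 < ∑ m ∈ Finset.univ.filter
            (fun m : Fin (2 * k) => 1 ≤ (m : ℕ) ∧ (m : ℕ) ≤ k - 1), α m ∧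
          (∑ m ∈ Finset.univ.filter
            (fun m : Fin (2 * k) => 1 ≤ (m : ℕ) ∧ (m : ℕ) ≤ k - 1), α m) ≠
            ∑ m ∈ Finset.univ.filter
              (fun m : Fin (2 * k) => k + 1 ≤ (m : ℕ) ∧ (m : ℕ) ≤ 2 * k - 1), α m) ∨
        ((∑ m ∈ Finset.univ.filter
            (fun m : Fin (2 * k) => 1 ≤ (m : ℕ) ∧ (m : ℕ) ≤ k - 1), α m) = 0 ∧
          0 < α ⟨0, by omega⟩ + α ⟨k, by omega⟩ ∧
          α ⟨0, by omega⟩ + α ⟨k, by omega⟩ < 1))) :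
    ¬ ∃ (φ₁ φ₂ : Matrix (Fin (2 * k)) (Fin (2 * k)) ℂ →ₗ[ℂ]
          Matrix (Fin (2 * k)) (Fin (2 * k)) ℂ),
        IsCP ⇑φ₁ ∧ IsCcP ⇑φ₂ ∧ Φ = φ₁ + φ₂ := by
  rintro ⟨φ₁, φ₂, h1, h2, hΦ⟩
  have : NeZero (2 * k) := ⟨by omega⟩
  have hk' : (1 : ℝ) ≤ k := by exact_mod_cast hk
  set f : Fin (2 * k) → ℝ := fun m => √(α m) * √(α (-m)) with hf
  set t : Fin (2 * k) → Fin (2 * k) → ℝ := fun i j => (φ₁ (Matrix.single i j 1) i j).re with ht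
  have hval : ∀ i j, (φ₁ (Matrix.single i i 1) j j).re + (φ₂ (Matrix.single i i 1) j j).re
      = α (j - i) := by
    intro i j
    have := congrFun (congrFun (hdiag i) j) j
    rw [hΦ] at this
    have := congrArg Complex.re this
    simpa [Matrix.sum_apply, Matrix.single_apply] using this
  have hvoff : ∀ i j, i ≠ j → (φ₁ (Matrix.single i j 1) i j).re
      + (φ₂ (Matrix.single i j 1) i j).re = -(1 / (2 * k - 1 : ℝ)) := by
    intro i j hij
    have := congrFun (congrFun (hoff i j hij) i) j
    rw [hΦ] at this
    have e : (-(1 / ((2 * k : ℂ) - 1))) = ((-(1 / (2 * k - 1 : ℝ)) : ℝ) : ℂ) := by push_cast; rfl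
    rw [e] at this
    generalize (-(1 / (2 * k - 1 : ℝ)) : ℝ) = c at this ⊢
    have := congrArg Complex.re this
    simpa [Matrix.single_apply] using this
  have hd1 := choi_diag _ h1
  have hd2 : ∀ i j, 0 ≤ (φ₂ (Matrix.single i i 1) j j).re := by
    intro i j
    have := choi_diag _ h2 i j
    simpa using this
  have hoffb : ∀ i j, i ≠ j → t i j + t j i ≤ 2 * f (j - i) - 2 / (2 * k - 1 : ℝ) := by
    intro i j hij
    have hp := choi_pair _ h2 hij
    simp only [Matrix.transpose_single] at hp
    have a1 := hval i j
    have a2 := hval j i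
    have b1 := hd1 i j
    have b2 := hd1 j i
    have o1 := hvoff i j hij
    have o2 := hvoff j i hij.symm
    have e : f (j - i) = √(α (j - i)) * √(α (i - j)) := by simp [hf]
    set r := (φ₂ (Matrix.single j i 1) j i).re + (φ₂ (Matrix.single i j 1) i j).re with hr
    have key : -r ≤ 2 * f (j - i) := by
      have hq : ∀ x y : ℝ, 0 ≤ x * x * α (j - i) + y * y * α (i - j) + x * y * r := by
        intro x y
        have := hp x y
        nlinarith [mul_nonneg (mul_self_nonneg x) b1, mul_nonneg (mul_self_nonneg y) b2]
      have hA := hα (j - i)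
      have hB := hα (i - j)
      have hdis : discrim (α (j - i)) r (α (i - j)) ≤ 0 := by
        apply discrim_le_zero
        intro x
        have := hq x 1
        linarith
      rw [e, ← Real.sqrt_mul hA]
      unfold discrim at hdis
      have : |r / 2| ≤ √(α (j - i) * α (i - j)) := by
        apply Real.abs_le_sqrt
        nlinarith
      have := neg_abs_le (r / 2)
      linarith
    have : t i j + t j i + r = - (2 / (2 * k - 1 : ℝ)) := by
      simp only [ht, hr]
      have : (2 / (2 * k - 1 : ℝ)) = 2 * (1 / (2 * k - 1 : ℝ)) := by ring
      rw [this]; linarith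
    linarith
  have hdb : ∀ i, t i i + t i i ≤ 2 * f (i - i) := by
    intro i
    have a := hval i i
    have b := hd2 i i
    have e : f (i - i) = α (i - i) := by
      simp [hf, Real.mul_self_sqrt (hα 0)]
    rw [e]; simp only [ht]; linarith
  have hall : ∀ i j, t i j + t j i ≤ 2 * f (j - i)
      + ((if i = j then 2 / (2 * k - 1 : ℝ) else 0) - 2 / (2 * k - 1 : ℝ)) := by
    intro i j
    by_cases hij : i = j
    · subst hij
      have := hdb i
      simp only [if_true]; linarith
    · have := hoffb i j hij
      simp only [hij, if_false]; linarith
  have hS : ∑ i, ∑ j, (t i j + t j i) ≤ ∑ i, ∑ j, (2 * f (j - i)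
      + ((if i = j then 2 / (2 * k - 1 : ℝ) else 0) - 2 / (2 * k - 1 : ℝ))) :=
    Finset.sum_le_sum fun i _ => Finset.sum_le_sum fun j _ => hall i j
  have h0 : 0 ≤ ∑ i, ∑ j, (t i j + t j i) := by
    have a : 0 ≤ ∑ i, ∑ j, t i j := choi_sum _ h1
    have b : ∑ i, ∑ j, t j i = ∑ i, ∑ j, t i j := Finset.sum_comm
    simp only [Finset.sum_add_distrib, b]; linarith
  have hshift : ∀ i, ∑ j, f (j - i) = ∑ m, f m := fun i =>
    (Equiv.subRight i).sum_comp f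
  have hf1 : 1 ≤ ∑ m, f m := by
    replace hS := h0.trans hS
    simp only [Finset.sum_add_distrib, Finset.sum_sub_distrib, ← Finset.mul_sum, hshift] at hS
    simp only [Finset.sum_ite_eq, Finset.mem_univ, if_true, Finset.sum_const, Finset.card_univ,
      Fintype.card_fin, nsmul_eq_mul] at hS
    push_cast at hS
    have hne : (2 * k - 1 : ℝ) ≠ 0 := by linarith
    have e : (2 * k : ℝ) * (2 / (2 * k - 1)) - 2 * k * (2 * k * (2 / (2 * k - 1))) = -(4 * k) := by
      field_simp; ring
    nlinarith
  have hneg : ∑ m, α (-m) = 1 := by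
    rw [← hsumα]; exact Equiv.sum_comp (Equiv.neg (Fin (2 * k))) α
  have hsq : ∑ m, (√(α m) - √(α (-m))) ^ 2 = 2 - 2 * ∑ m, f m := by
    have : ∀ m, (√(α m) - √(α (-m))) ^ 2 = α m + α (-m) - 2 * f m := by
      intro m
      have a := Real.sq_sqrt (hα m)
      have b := Real.sq_sqrt (hα (-m))
      simp only [hf]; linear_combination a + b
    simp only [this, Finset.sum_sub_distrib, Finset.sum_add_distrib, ← Finset.mul_sum, hneg, hsumα]
    ring
  have hsym : ∀ m, α (-m) = α m := by
    intro m
    have hz : ∑ m, (√(α m) - √(α (-m))) ^ 2 = 0 :=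
      le_antisymm (by linarith) (Finset.sum_nonneg fun _ _ => sq_nonneg _)
    have := (Finset.sum_eq_zero_iff_of_nonneg (fun _ _ => sq_nonneg _)).1 hz m (Finset.mem_univ m)
    have : √(α m) = √(α (-m)) := by
      have := pow_eq_zero_iff (two_ne_zero) |>.1 this
      linarith
    exact ((Real.sqrt_inj (hα _) (hα _)).1 this).symm
  have hmir : (∑ m ∈ Finset.univ.filter
            (fun m : Fin (2 * k) => 1 ≤ (m : ℕ) ∧ (m : ℕ) ≤ k - 1), α m) =
            ∑ m ∈ Finset.univ.filter
              (fun m : Fin (2 * k) => k + 1 ≤ (m : ℕ) ∧ (m : ℕ) ≤ 2 * k - 1), α m := by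
    have hnv : ∀ m : Fin (2 * k), 1 ≤ (m : ℕ) → ((-m : Fin (2 * k)) : ℕ) = 2 * k - m := by
      intro m hm
      rw [Fin.val_neg', Nat.mod_eq_of_lt]
      omega
    refine Finset.sum_nbij' (fun m => -m) (fun m => -m) ?_ ?_ ?_ ?_ ?_
    · intro m hm
      simp only [Finset.mem_filter, Finset.mem_univ, true_and] at hm ⊢
      rw [hnv m hm.1]; omega
    · intro m hm
      simp only [Finset.mem_filter, Finset.mem_univ, true_and] at hm ⊢
      have := m.isLt
      rw [hnv m (by omega)]; omega
    · simp
    · simp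
    · intro m _; exact (hsym m).symm
  rcases hcond with ⟨_, hne⟩ | ⟨hz, _, hlt⟩
  · exact hne hmir
  · rw [hz] at hmir
    have z1 := (Finset.sum_eq_zero_iff_of_nonneg (fun m _ => hα m)).1 hz
    have z2 := (Finset.sum_eq_zero_iff_of_nonneg (fun m _ => hα m)).1 hmir.symm
    have : ∑ m, α m = α ⟨0, by omega⟩ + α ⟨k, by omega⟩ := by
      apply Finset.sum_eq_add
      · intro h; simp at h; omega
      · intro m _ hm
        have c1 : (m : ℕ) ≠ 0 := fun h => hm.1 (Fin.ext h)
        have c2 : (m : ℕ) ≠ k := fun h => hm.2 (Fin.ext h)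
        have := m.isLt
        by_cases h : (m : ℕ) < k
        · exact z1 m (by simp; omega)
        · exact z2 m (by simp; omega)
      · simp
      · simp
    linarith
end
end

section
/- Let k ≥ 1, d = 2k+1, let α_0, …, α_{d−1} be nonnegative reals with sum 1, let a_{ij} = α_{(j−i) mod d}, and let φ : M_d(ℂ) → M_d(ℂ) be the linear map with φ(e_{ii}) = Σ_j a_{ij} e_{jj} and φ(e_{ij}) = −(1/(d−1)) e_{ij} for i ≠ j. For a > 0 define ρ_a = Σ_{i,j} a·(e_{ij} ⊗ e_{ij}) + Σ_{i≠j} D_{ij}·(e_{ii} ⊗ e_{jj}) ∈ M_{d²}(ℂ), where D_{i,(i+m) mod d} = a² for m = 1,…,k and D_{i,(i+m) mod d} = 1 for m = k+1,…,2k. Then ρ_a is PPT (ρ_a and its partial transpose are positive semidefinite), and Tr(φ̂·ρ_a) = d·( −a(1−α_0) + a²(α_1 + ⋯ + α_k) + (α_{k+1} + ⋯ + α_{2k}) ), where φ̂ = Σ_{i,j} e_{ij} ⊗ φ(e_{ij}). -/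
open Matrix BigOperators ComplexOrder Kronecker
open scoped Fin.NatCast

noncomputable section

/-- Choi–Jamiołkowski matrix `φ̂ = ∑_{i,j} e_{ij} ⊗ φ(e_{ij})`. -/
def choi {d : ℕ} (φ : Matrix (Fin d) (Fin d) ℂ → Matrix (Fin d) (Fin d) ℂ) :
    Matrix (Fin d × Fin d) (Fin d × Fin d) ℂ :=
  ∑ i, ∑ j, Matrix.single i j (1 : ℂ) ⊗ₖ φ (Matrix.single i j (1 : ℂ))

/-- `ρ_a = ∑_{i,j} a (e_{ij} ⊗ e_{ij}) + ∑_{i≠j} D_{ij} (e_{ii} ⊗ e_{jj})` where, for `i ≠ j`,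
`D_{i,(i+m) mod d} = a²` for `m = 1,…,k` and `D_{i,(i+m) mod d} = 1` for `m = k+1,…,2k`
(here `d = 2k+1`). -/
def rhoA (k : ℕ) (a : ℝ) :
    Matrix (Fin (2 * k + 1) × Fin (2 * k + 1)) (Fin (2 * k + 1) × Fin (2 * k + 1)) ℂ :=
  (∑ i, ∑ j, (a : ℂ) • (Matrix.single i j (1 : ℂ) ⊗ₖ Matrix.single i j (1 : ℂ))) +
    ∑ i, ∑ j,
      (if i = j then 0
       else if ((j - i : Fin (2 * k + 1)) : ℕ) ≤ k then ((a : ℂ)) ^ 2 else 1) •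
        (Matrix.single i i (1 : ℂ) ⊗ₖ Matrix.single j j (1 : ℂ))

def dA (k : ℕ) (a : ℝ) (m : Fin (2 * k + 1)) : ℝ :=
  if m = 0 then 0 else if (m : ℕ) ≤ k then a ^ 2 else 1

lemma choi_apply' {d : ℕ} (φ : Matrix (Fin d) (Fin d) ℂ → Matrix (Fin d) (Fin d) ℂ)
    (p q : Fin d × Fin d) : choi φ p q = φ (Matrix.single p.1 q.1 1) p.2 q.2 := by
  unfold choi
  simp only [Matrix.sum_apply, Matrix.kroneckerMap_apply, Matrix.single_apply]
  rw [Finset.sum_eq_single p.1 (fun b _ hb => by simp [hb]) (by simp),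
    Finset.sum_eq_single q.1 (fun b _ hb => by simp [hb]) (by simp)]
  simp

lemma rhoA_apply' (k : ℕ) (a : ℝ) (p q : Fin (2 * k + 1) × Fin (2 * k + 1)) :
    rhoA k a p q = (if p.1 = p.2 ∧ q.1 = q.2 then (a : ℂ) else 0) +
      (if p = q then (dA k a (p.2 - p.1) : ℂ) else 0) := by
  unfold rhoA
  simp only [Matrix.add_apply, Matrix.sum_apply, Matrix.smul_apply, Matrix.kroneckerMap_apply,
    Matrix.single_apply]
  congr 1
  · rw [Finset.sum_eq_single p.1 (fun b _ hb => by simp [hb]) (by simp),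
      Finset.sum_eq_single q.1 (fun b _ hb => by simp [hb]) (by simp)]
    simp
  · rw [Finset.sum_eq_single p.1 (fun b _ hb => by simp [hb]) (by simp),
      Finset.sum_eq_single p.2 (fun b _ hb => by simp [hb]) (by simp)]
    have h : p.2 - p.1 = 0 ↔ p.1 = p.2 := by rw [sub_eq_zero, eq_comm]
    by_cases hpq : p = q
    · subst hpq
      simp only [dA, h]
      split_ifs <;> simp_all
    · have : ¬ (p.1 = q.1 ∧ p.2 = q.2) := fun h => hpq (Prod.ext h.1 h.2)
      simp only [hpq, if_false]
      by_cases h1 : p.1 = q.1 <;> by_cases h2 : p.2 = q.2 <;> simp_all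

lemma dA_nonneg (k : ℕ) (a : ℝ) (m) : 0 ≤ dA k a m := by
  unfold dA; split_ifs <;> positivity

lemma rhoA_psd (k : ℕ) (a : ℝ) (ha : 0 < a) : (rhoA k a).PosSemidef := by
  have h : rhoA k a = (a : ℂ) • Matrix.vecMulVec
      (fun p : Fin (2 * k + 1) × Fin (2 * k + 1) => if p.1 = p.2 then (1 : ℂ) else 0)
      (star (fun p : Fin (2 * k + 1) × Fin (2 * k + 1) => if p.1 = p.2 then (1 : ℂ) else 0)) +
      Matrix.diagonal (fun p => (dA k a (p.2 - p.1) : ℂ)) := by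
    ext p q
    rw [rhoA_apply']
    simp only [Matrix.add_apply, Matrix.smul_apply, Matrix.vecMulVec_apply, Matrix.diagonal_apply,
      Pi.star_apply]
    congr 1
    by_cases h1 : p.1 = p.2 <;> by_cases h2 : q.1 = q.2 <;> simp [h1, h2]
  rw [h]
  refine Matrix.PosSemidef.add ?_ ?_
  · exact (Matrix.posSemidef_vecMulVec_self_star _).smul (by exact_mod_cast ha.le)
  · exact Matrix.PosSemidef.diagonal (fun p => by simpa using dA_nonneg k a _)

def sA (k : ℕ) (a : ℝ) (m : Fin (2 * k + 1)) : ℝ :=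
  if m = 0 then √(a / 2) else if (m : ℕ) ≤ k then a else 1

lemma sA_mul (k : ℕ) (a : ℝ) (m : Fin (2 * k + 1)) (hm : m ≠ 0) :
    sA k a m * sA k a (-m) = a := by
  have h2 : -m ≠ 0 := neg_ne_zero.mpr hm
  have h3 : ((-m : Fin (2 * k + 1)) : ℕ) = 2 * k + 1 - m := by
    rw [Fin.val_neg]; simp [hm]
  have h4 : (m : ℕ) ≠ 0 := fun h => hm (Fin.ext h)
  have := m.2
  simp only [sA, hm, h2, if_false, h3]
  split_ifs
  · omega
  · simp
  · simp
  · omega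

lemma sA_sq (k : ℕ) (a : ℝ) (m : Fin (2 * k + 1)) (hm : m ≠ 0) :
    sA k a m * sA k a m = dA k a m := by
  simp only [sA, dA, hm, if_false]
  split_ifs <;> ring

lemma ptrans_psd (k : ℕ) (a : ℝ) (ha : 0 < a) : (ptrans (rhoA k a)).PosSemidef := by
  set N := Fin (2 * k + 1) × Fin (2 * k + 1)
  let B : Matrix N N ℂ := Matrix.of fun r p =>
    (sA k a (p.2 - p.1) : ℂ) * ((if r = p then 1 else 0) + (if r = p.swap then 1 else 0))
  have h : ptrans (rhoA k a) = (1 / 2 : ℂ) • (Bᴴ * B) := by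
    ext p q
    have e1 : (Bᴴ * B) p q = (sA k a (p.2 - p.1) : ℂ) * (sA k a (q.2 - q.1) : ℂ) *
        (2 * (if p = q then 1 else 0) + 2 * (if p = q.swap then 1 else 0)) := by
      simp only [Matrix.mul_apply, Matrix.conjTranspose_apply, B, Matrix.of_apply]
      have : ∀ r : N, star ((sA k a (p.2 - p.1) : ℂ) *
          ((if r = p then 1 else 0) + (if r = p.swap then 1 else 0))) *
          ((sA k a (q.2 - q.1) : ℂ) * ((if r = q then 1 else 0) + (if r = q.swap then 1 else 0)))
          = (sA k a (p.2 - p.1) : ℂ) * (sA k a (q.2 - q.1) : ℂ) *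
          ((if r = p then ((if r = q then 1 else 0) + (if r = q.swap then 1 else 0)) else 0) +
           (if r = p.swap then ((if r = q then 1 else 0) + (if r = q.swap then 1 else 0)) else 0)) := by
        intro r
        simp only [star_mul', star_add, Complex.star_def, Complex.conj_ofReal, apply_ite (starRingEnd ℂ),
          map_one, map_zero]
        split_ifs <;> ring
      rw [Finset.sum_congr rfl (fun r _ => this r), ← Finset.mul_sum, Finset.sum_add_distrib]
      simp only [Finset.sum_ite_eq', Finset.mem_univ, if_true]
      have i1 : p.swap = q ↔ p = q.swap := Prod.swap_eq_iff_eq_swap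
      have i2 : p.swap = q.swap ↔ p = q := Prod.swap_inj
      simp only [i1, i2]
      ring
    rw [Matrix.smul_apply, e1]
    obtain ⟨i, j⟩ := p
    obtain ⟨i', j'⟩ := q
    simp only [ptrans, Matrix.of_apply, rhoA_apply', Prod.swap_prod_mk, Prod.mk.injEq, smul_eq_mul]
    by_cases hij : i = j
    · subst hij
      by_cases c : i = i' ∧ i = j'
      · obtain ⟨rfl, rfl⟩ := c
        have hs : ((√(a / 2) : ℝ) : ℂ) * ((√(a / 2) : ℝ) : ℂ) = (a : ℂ) / 2 := by
          rw [← Complex.ofReal_mul, Real.mul_self_sqrt (by positivity)]; simp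
        simp only [sub_self, sA, dA, if_true, and_self, hs]
        push_cast; ring
      · have c' : ¬ (i = j' ∧ i = i') := fun h => c ⟨h.2, h.1⟩
        have c2 : ¬ (i = j' ∧ i' = i) := fun h => c ⟨h.2.symm, h.1⟩
        have c3 : ¬ (i = i' ∧ j' = i) := fun h => c ⟨h.1, h.2.symm⟩
        simp [c, c', c2, c3]
    · have hne : j - i ≠ 0 := sub_ne_zero.mpr (Ne.symm hij)
      by_cases c : i = i' ∧ j = j'
      · obtain ⟨rfl, rfl⟩ := c
        have := sA_sq k a _ hne
        simp only [hij, ← this, false_and, if_false, and_self, if_true]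
        push_cast; ring
      · have c3 : ¬ (i = i' ∧ j' = j) := fun h => c ⟨h.1, h.2.symm⟩
        by_cases e : i = j' ∧ j = i'
        · obtain ⟨rfl, rfl⟩ := e
          have := sA_mul k a _ hne
          rw [neg_sub] at this
          simp only [hij, false_and, if_false, and_self, if_true, ← Complex.ofReal_mul, this]
          push_cast; ring
        · have e2 : ¬ (i = j' ∧ i' = j) := fun h => e ⟨h.1, h.2.symm⟩
          simp [c, c3, e, e2]
  rw [h]
  refine (Matrix.posSemidef_conjTranspose_mul_self B).smul ?_
  rw [show (1 / 2 : ℂ) = ((1 / 2 : ℝ) : ℂ) by push_cast; rfl]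
  exact_mod_cast (by norm_num : (0 : ℝ) ≤ 1 / 2)

lemma sum_dA (k : ℕ) (a : ℝ) (α : Fin (2 * k + 1) → ℝ) :
    ∑ m, dA k a m * α m = a ^ 2 * (∑ m ∈ Finset.Icc 1 k, α (m : Fin (2 * k + 1))) +
            ∑ m ∈ Finset.Icc (k + 1) (2 * k), α (m : Fin (2 * k + 1)) := by
  have h1 : ∀ m : Fin (2 * k + 1), dA k a m * α m =
      (fun n : ℕ => (if n = 0 then 0 else if n ≤ k then a ^ 2 else 1) *
        α (n : Fin (2 * k + 1))) m := by
    intro m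
    have : m = 0 ↔ (m : ℕ) = 0 := by rw [Fin.ext_iff]; rfl
    have hc : ((m : ℕ) : Fin (2 * k + 1)) = m := Fin.cast_val_eq_self m
    simp only [dA, hc]
    congr 1
    by_cases hm : m = 0
    · rw [if_pos hm, if_pos (this.mp hm)]
    · rw [if_neg hm, if_neg (fun h => hm (this.mpr h))]
  rw [Finset.sum_congr rfl (fun m _ => h1 m),
    Fin.sum_univ_eq_sum_range (fun n : ℕ => (if n = 0 then 0 else if n ≤ k then a ^ 2 else 1) *
        α (n : Fin (2 * k + 1))) (2 * k + 1)]
  have h2 : Finset.range (2 * k + 1) = insert 0 (Finset.Icc 1 k ∪ Finset.Icc (k + 1) (2 * k)) := by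
    ext x; simp only [Finset.mem_range, Finset.mem_insert, Finset.mem_union, Finset.mem_Icc]; omega
  rw [h2, Finset.sum_insert (by simp), Finset.sum_union, Finset.mul_sum]
  · simp only [if_true, zero_mul, zero_add]
    congr 1
    · refine Finset.sum_congr rfl fun x hx => ?_
      rw [Finset.mem_Icc] at hx
      rw [if_neg (by omega), if_pos hx.2]
    · refine Finset.sum_congr rfl fun x hx => ?_
      rw [Finset.mem_Icc] at hx
      rw [if_neg (by omega), if_neg (by omega), one_mul]
  · rw [Finset.disjoint_left]
    intro x; simp only [Finset.mem_Icc]; omega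

theorem stmt12 {k : ℕ} (hk : 1 ≤ k) (α : Fin (2 * k + 1) → ℝ)
    (hα : ∀ m, 0 ≤ α m) (hsumα : ∑ m, α m = 1)
    (Φ : Matrix (Fin (2 * k + 1)) (Fin (2 * k + 1)) ℂ →ₗ[ℂ]
          Matrix (Fin (2 * k + 1)) (Fin (2 * k + 1)) ℂ)
    (hdiag : ∀ i, Φ (Matrix.single i i 1) =
      ∑ j, ((α (j - i) : ℝ) : ℂ) • Matrix.single j j (1 : ℂ))
    (hoff : ∀ i j, i ≠ j → Φ (Matrix.single i j 1) =
      (-(1 / ((2 * k + 1 : ℂ) - 1))) • Matrix.single i j (1 : ℂ))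
    (a : ℝ) (haa : 0 < a) :
    ((rhoA k a).PosSemidef ∧ (ptrans (rhoA k a)).PosSemidef) ∧
      Matrix.trace (choi ⇑Φ * rhoA k a) =
        (((2 * k + 1 : ℝ) *
          (-(a * (1 - α 0)) + a ^ 2 * (∑ m ∈ Finset.Icc 1 k, α (m : Fin (2 * k + 1))) +
            ∑ m ∈ Finset.Icc (k + 1) (2 * k), α (m : Fin (2 * k + 1))) : ℝ) : ℂ) := by
  refine ⟨⟨rhoA_psd k a haa, ptrans_psd k a haa⟩, ?_⟩
  have hk0 : (k : ℂ) ≠ 0 := by exact_mod_cast (by omega : k ≠ 0)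
  have hD : ∀ i j l, Φ (Matrix.single i i 1) j l = if j = l then ((α (j - i) : ℝ) : ℂ) else 0 := by
    intro i j l
    rw [hdiag]
    simp only [Matrix.sum_apply, Matrix.smul_apply, Matrix.single_apply]
    rw [Finset.sum_eq_single j (fun b _ hb => by simp [hb]) (by simp)]
    simp
  have hE : ∀ i j, Φ (Matrix.single i j 1) i j =
      if i = j then ((α 0 : ℝ) : ℂ) + 1 / (2 * k) - 1 / (2 * k) else -(1 / (2 * k : ℂ)) := by
    intro i j
    by_cases h : i = j
    · subst h; rw [hD]; simp
    · rw [hoff i j h]; simp [h]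
  have hE' : ∀ i j, Φ (Matrix.single i j 1) i j =
      (if i = j then ((α 0 : ℝ) : ℂ) + 1 / (2 * k) else 0) - 1 / (2 * k) := by
    intro i j
    rw [hE]; split_ifs <;> ring
  have key : Matrix.trace (choi ⇑Φ * rhoA k a) =
      (∑ i, ∑ j, Φ (Matrix.single i j 1) i j * (a : ℂ)) +
      ∑ i, ∑ j, Φ (Matrix.single i i 1) j j * (dA k a (j - i) : ℂ) := by
    simp only [Matrix.trace, Matrix.diag_apply, Matrix.mul_apply, choi_apply', rhoA_apply', mul_add,
      Finset.sum_add_distrib]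
    congr 1
    · simp only [Fintype.sum_prod_type]
      refine Finset.sum_congr rfl fun i _ => ?_
      rw [Finset.sum_eq_single i (fun b _ hb => by simp [Ne.symm hb]) (by simp)]
      refine Finset.sum_congr rfl fun j _ => ?_
      rw [Finset.sum_eq_single j (fun b _ hb => by simp [Ne.symm hb]) (by simp)]
      simp
    · rw [← Fintype.sum_prod_type' (f := fun i j =>
        Φ (Matrix.single i i 1) j j * (dA k a (j - i) : ℂ))]
      refine Finset.sum_congr rfl fun p _ => ?_
      rw [Finset.sum_eq_single p (fun b _ hb => by simp [hb]) (by simp)]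
      simp
  have h2 : ∀ i, ∑ j, Φ (Matrix.single i i 1) j j * (dA k a (j - i) : ℂ) =
      ((∑ m, dA k a m * α m : ℝ) : ℂ) := by
    intro i
    push_cast
    rw [← Equiv.sum_comp (Equiv.subRight i) (fun m => (dA k a m : ℂ) * (α m : ℂ))]
    refine Finset.sum_congr rfl fun j _ => ?_
    rw [hD]; simp [mul_comm]
  have h1 : ∀ i, ∑ j, Φ (Matrix.single i j 1) i j * (a : ℂ) = (α 0 - 1) * a := by
    intro i
    rw [← Finset.sum_mul]
    simp only [hE', Finset.sum_sub_distrib, Finset.sum_ite_eq, Finset.mem_univ, if_true,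
      Finset.sum_const, Finset.card_univ, Fintype.card_fin, nsmul_eq_mul]
    push_cast
    field_simp
    ring
  rw [key, Finset.sum_congr rfl (fun i _ => h1 i), Finset.sum_congr rfl (fun i _ => h2 i), sum_dA]
  simp only [Finset.sum_const, Finset.card_univ, Fintype.card_fin, nsmul_eq_mul]
  push_cast
  ring
end
end
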